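/- Fix H ∈ (0,1), N ≥ 1 and 0 < a < b < ∞, and define for s, t ∈ [a,b]^N the fractional Brownian sheet correlation ρ_H(s,t) = ∏_{i=1}^N (s_i^{2H} + t_i^{2H} − |t_i − s_i|^{2H})/(2 s_i^H t_i^H). Then there exist δ > 0 and finite constants 0 < C_4 ≤ C_5 such that for all s, t ∈ [a,b]^N with ‖t − s‖ ≤ δ: C_4 ‖t − s‖^{2H} ≤ 1 − ρ_H(s,t)² ≤ C_5 ‖t − s‖^{2H}. -/

import Mathlib

open MeasureTheory ProbabilityTheory
open scoped ENNReal NNReal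

noncomputable section

/-- Euclidean space `ℝ^n`. -/
abbrev Rv (n : ℕ) := EuclideanSpace ℝ (Fin n)

/-- The cube `[a,b]^N`. -/
def box (N : ℕ) (a b : ℝ) : Set (Rv N) := {t | ∀ i, t i ∈ Set.Icc a b}

/-- The open positive orthant `(0,∞)^N`. -/
def posOrthant (N : ℕ) : Set (Rv N) := {t | ∀ i, 0 < t i}

/-- The correlation of two values of a one-dimensional fractional Brownian motion differs from `1`
by a quantity comparable to `|t - s| ^ (2 * H)`, locally uniformly away from `0`. -/
lemma exists_fbm_correlation_bounds {H a b : ℝ} (hH0 : 0 < H) (hH1 : H < 1) (ha : 0 < a)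
    (hab : a < b) :
    ∃ δ : ℝ, 0 < δ ∧ ∀ s ∈ Set.Icc a b, ∀ t ∈ Set.Icc a b, |t - s| ≤ δ →
      0 ≤ (s ^ (2 * H) + t ^ (2 * H) - |t - s| ^ (2 * H)) / (2 * s ^ H * t ^ H) ∧
      |t - s| ^ (2 * H) / (4 * b ^ (2 * H)) ≤
        1 - (s ^ (2 * H) + t ^ (2 * H) - |t - s| ^ (2 * H)) / (2 * s ^ H * t ^ H) ∧
      1 - (s ^ (2 * H) + t ^ (2 * H) - |t - s| ^ (2 * H)) / (2 * s ^ H * t ^ H) ≤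
        |t - s| ^ (2 * H) / (2 * a ^ (2 * H)) := by
  have hb : 0 < b := ha.trans hab
  have two_mul_rpow {x : ℝ} (hx : 0 ≤ x) : x ^ (2 * H) = (x ^ H) ^ 2 := by
    rw [mul_comm, Real.rpow_mul hx, Real.rpow_two]
  set K : ℝ := b ^ H / a with hK
  have hKpos : 0 < K := by positivity
  have lip {s t : ℝ} (hs : s ∈ Set.Icc a b) (hst : s ≤ t) : t ^ H - s ^ H ≤ K * (t - s) := by
    have hs0 : 0 < s := ha.trans_le hs.1
    have h1 : (t / s) ^ H ≤ t / s := by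
      have h : 1 ≤ t / s := (one_le_div hs0).2 hst
      simpa using Real.rpow_le_rpow_of_exponent_le h hH1.le
    rw [Real.div_rpow (hs0.le.trans hst) hs0.le, div_le_iff₀ (by positivity)] at h1
    have h2 : s ^ H / s ≤ K := by
      rw [hK]
      gcongr
      exacts [hs.2, hs.1]
    calc t ^ H - s ^ H ≤ t / s * s ^ H - s ^ H := by gcongr
      _ = s ^ H / s * (t - s) := by field_simp
      _ ≤ K * (t - s) := by gcongr
  refine ⟨min a ((1 / (2 * K ^ 2)) ^ (2 - 2 * H)⁻¹), by positivity, ?_⟩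
  intro s hs t ht hδ
  have hs0 : 0 < s := ha.trans_le hs.1
  have ht0 : 0 < t := ha.trans_le ht.1
  set x := |t - s| with hx
  have hx0 : 0 ≤ x := abs_nonneg _
  have hxa : x ^ (2 * H) ≤ a ^ (2 * H) :=
    Real.rpow_le_rpow hx0 (hδ.trans (min_le_left _ _)) (by positivity)
  have hxK : x ^ (2 - 2 * H) ≤ 1 / (2 * K ^ 2) := by
    have hne : 2 - 2 * H ≠ 0 := by linarith
    calc x ^ (2 - 2 * H) ≤ ((1 / (2 * K ^ 2)) ^ (2 - 2 * H)⁻¹) ^ (2 - 2 * H) :=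
          Real.rpow_le_rpow hx0 (hδ.trans (min_le_right _ _)) (by linarith)
      _ = 1 / (2 * K ^ 2) := Real.rpow_inv_rpow (by positivity) hne
  have hsq : (t ^ H - s ^ H) ^ 2 ≤ x ^ (2 * H) / 2 := by
    have habs : |t ^ H - s ^ H| ≤ K * x := by
      rcases le_total s t with h | h
      · rw [hx, abs_of_nonneg (sub_nonneg.2 h),
          abs_of_nonneg (sub_nonneg.2 (Real.rpow_le_rpow hs0.le h hH0.le))]
        exact lip hs h
      · rw [hx, abs_sub_comm, abs_sub_comm t, abs_of_nonneg (sub_nonneg.2 h),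
          abs_of_nonneg (sub_nonneg.2 (Real.rpow_le_rpow ht0.le h hH0.le))]
        exact lip ht h
    have hsplit : x ^ 2 = x ^ (2 * H) * x ^ (2 - 2 * H) := by
      rw [← Real.rpow_add' hx0 (by norm_num)]
      norm_num
    calc (t ^ H - s ^ H) ^ 2 = |t ^ H - s ^ H| ^ 2 := (sq_abs _).symm
      _ ≤ (K * x) ^ 2 := by gcongr
      _ = K ^ 2 * (x ^ (2 * H) * x ^ (2 - 2 * H)) := by rw [mul_pow, hsplit]
      _ ≤ K ^ 2 * (x ^ (2 * H) * (1 / (2 * K ^ 2))) := by gcongr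
      _ = x ^ (2 * H) / 2 := by field_simp
  have hsa : a ^ H ≤ s ^ H := Real.rpow_le_rpow ha.le hs.1 hH0.le
  have hta : a ^ H ≤ t ^ H := Real.rpow_le_rpow ha.le ht.1 hH0.le
  have hsb : s ^ H ≤ b ^ H := Real.rpow_le_rpow hs0.le hs.2 hH0.le
  have htb : t ^ H ≤ b ^ H := Real.rpow_le_rpow ht0.le ht.2 hH0.le
  have hX0 : 0 ≤ x ^ (2 * H) := by positivity
  rw [two_mul_rpow ha.le] at hxa
  rw [two_mul_rpow hs0.le, two_mul_rpow ht0.le, two_mul_rpow ha.le, two_mul_rpow hb.le]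
  have hA : 0 < a ^ H := by positivity
  have hS : 0 < s ^ H := by positivity
  have hT : 0 < t ^ H := by positivity
  have hB : 0 < b ^ H := by positivity
  generalize x ^ (2 * H) = X at *
  generalize a ^ H = A at *
  generalize s ^ H = S at *
  generalize t ^ H = T at *
  generalize b ^ H = B at *
  have hrew : 1 - (S ^ 2 + T ^ 2 - X) / (2 * S * T) = (X - (T - S) ^ 2) / (2 * S * T) := by
    field_simp
    ring
  have hA2 : A ^ 2 ≤ S * T := by rw [sq]; gcongr
  have hB2 : S * T ≤ B ^ 2 := by rw [sq]; gcongr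
  refine ⟨div_nonneg (by nlinarith) (by positivity), ?_, ?_⟩
  · rw [hrew]
    calc X / (4 * B ^ 2) = (X / 2) / (2 * B ^ 2) := by field_simp; norm_num
      _ ≤ (X - (T - S) ^ 2) / (2 * S * T) :=
        div_le_div₀ (by linarith) (by linarith) (by positivity) (by nlinarith)
  · rw [hrew]
    exact div_le_div₀ hX0 (by nlinarith) (by positivity) (by nlinarith)

/-- Weierstrass product inequality. -/
lemma one_sub_prod_le_sum_one_sub {ι : Type*} (I : Finset ι) {r : ι → ℝ}
    (h0 : ∀ i ∈ I, 0 ≤ r i) (h1 : ∀ i ∈ I, r i ≤ 1) :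
    1 - ∏ i ∈ I, r i ≤ ∑ i ∈ I, (1 - r i) := by
  classical
  induction I using Finset.induction_on with
  | empty => simp
  | insert j I hj ih =>
    rw [Finset.prod_insert hj, Finset.sum_insert hj]
    have h0' : ∀ i ∈ I, 0 ≤ r i := fun i hi => h0 i (Finset.mem_insert_of_mem hi)
    have h1' : ∀ i ∈ I, r i ≤ 1 := fun i hi => h1 i (Finset.mem_insert_of_mem hi)
    have hle : ∏ i ∈ I, r i ≤ 1 := Finset.prod_le_one h0' h1'
    have := h1 j (Finset.mem_insert_self j I)
    nlinarith [ih h0' h1']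

/-- The Euclidean norm is at most the dimension times some coordinate. -/
lemma exists_norm_le_card_mul_abs {N : ℕ} (hN : 1 ≤ N) (v : Rv N) :
    ∃ j, ‖v‖ ≤ N * |v j| := by
  have : Nonempty (Fin N) := ⟨⟨0, hN⟩⟩
  obtain ⟨j, hj⟩ := Finite.exists_max fun i => |v i|
  refine ⟨j, ?_⟩
  have hN' : (1 : ℝ) ≤ N := by exact_mod_cast hN
  rw [EuclideanSpace.norm_eq]
  refine Real.sqrt_le_iff.2 ⟨by positivity, ?_⟩
  calc ∑ i, ‖v i‖ ^ 2 ≤ ∑ _i : Fin N, |v j| ^ 2 := by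
        gcongr with i
        exact hj i
    _ = N * |v j| ^ 2 := by simp
    _ ≤ (N * N) * |v j| ^ 2 := by gcongr; nlinarith
    _ = (N * |v j|) ^ 2 := by ring

/-- Condition (3.3) of Hypothesis A1 with `α = H` for the fractional Brownian sheet
correlation `ρ_H`. -/
theorem statement16 (H : ℝ) (hH : H ∈ Set.Ioo (0 : ℝ) 1)
    (N : ℕ) (hN : 1 ≤ N) (a b : ℝ) (ha : 0 < a) (hab : a < b) :
    ∃ δ C4 C5 : ℝ, 0 < δ ∧ 0 < C4 ∧ C4 ≤ C5 ∧
      ∀ s ∈ box N a b, ∀ t ∈ box N a b, ‖t - s‖ ≤ δ →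
        C4 * ‖t - s‖ ^ (2 * H)
            ≤ 1 - (∏ i, (s i ^ (2 * H) + t i ^ (2 * H) - |t i - s i| ^ (2 * H)) /
                (2 * s i ^ H * t i ^ H)) ^ 2 ∧
        1 - (∏ i, (s i ^ (2 * H) + t i ^ (2 * H) - |t i - s i| ^ (2 * H)) /
                (2 * s i ^ H * t i ^ H)) ^ 2
            ≤ C5 * ‖t - s‖ ^ (2 * H) := by
  obtain ⟨hH0, hH1⟩ := hH
  have hb : 0 < b := ha.trans hab
  have hN0 : (0 : ℝ) < N := by exact_mod_cast hN
  obtain ⟨δ, hδ, hfac⟩ := exists_fbm_correlation_bounds hH0 hH1 ha hab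
  refine ⟨δ, 1 / (4 * b ^ (2 * H) * (N : ℝ) ^ (2 * H)),
    1 / (4 * b ^ (2 * H) * (N : ℝ) ^ (2 * H)) + N / a ^ (2 * H), hδ, by positivity,
    le_add_of_nonneg_right (by positivity), ?_⟩
  intro s hs t ht hst
  have hcoord : ∀ i, |t i - s i| ≤ ‖t - s‖ := fun i => by
    simpa using PiLp.norm_apply_le (t - s) i
  have hbd := fun i => hfac (s i) (hs i) (t i) (ht i) ((hcoord i).trans hst)
  generalize hr : (fun i => (s i ^ (2 * H) + t i ^ (2 * H) - |t i - s i| ^ (2 * H)) /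
    (2 * s i ^ H * t i ^ H)) = r
  have hri : ∀ i, (s i ^ (2 * H) + t i ^ (2 * H) - |t i - s i| ^ (2 * H)) /
    (2 * s i ^ H * t i ^ H) = r i := fun i => congrFun hr i
  simp only [hri] at hbd ⊢
  have h0 : ∀ i, 0 ≤ r i := fun i => (hbd i).1
  have h1 : ∀ i, r i ≤ 1 := fun i => by
    have : 0 ≤ |t i - s i| ^ (2 * H) / (4 * b ^ (2 * H)) := by positivity
    linarith [(hbd i).2.1]
  have hP0 : 0 ≤ ∏ i, r i := Finset.prod_nonneg fun i _ => h0 i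
  have hP1 : ∏ i, r i ≤ 1 := Finset.prod_le_one (fun i _ => h0 i) fun i _ => h1 i
  constructor
  · obtain ⟨j, hj⟩ := exists_norm_le_card_mul_abs hN (t - s)
    rw [PiLp.sub_apply] at hj
    have hPj : ∏ i, r i ≤ r j := by
      rw [← Finset.mul_prod_erase _ _ (Finset.mem_univ j)]
      exact mul_le_of_le_one_right (h0 j) (Finset.prod_le_one (fun i _ => h0 i) fun i _ => h1 i)
    calc 1 / (4 * b ^ (2 * H) * (N : ℝ) ^ (2 * H)) * ‖t - s‖ ^ (2 * H)
        ≤ 1 / (4 * b ^ (2 * H) * (N : ℝ) ^ (2 * H)) * (N * |t j - s j|) ^ (2 * H) := by gcongr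
      _ = |t j - s j| ^ (2 * H) / (4 * b ^ (2 * H)) := by
        rw [Real.mul_rpow hN0.le (abs_nonneg _)]
        field_simp
      _ ≤ 1 - r j := (hbd j).2.1
      _ ≤ 1 - (∏ i, r i) ^ 2 := by nlinarith
  · calc 1 - (∏ i, r i) ^ 2 ≤ 2 * (1 - ∏ i, r i) := by nlinarith
      _ ≤ 2 * ∑ i, (1 - r i) := by
        gcongr
        exact one_sub_prod_le_sum_one_sub _ (fun i _ => h0 i) fun i _ => h1 i
      _ ≤ 2 * ∑ _i : Fin N, ‖t - s‖ ^ (2 * H) / (2 * a ^ (2 * H)) := by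
        gcongr with i
        refine (hbd i).2.2.trans ?_
        gcongr
        exact hcoord i
      _ = N / a ^ (2 * H) * ‖t - s‖ ^ (2 * H) := by
        rw [Finset.sum_const, Finset.card_univ, Fintype.card_fin, nsmul_eq_mul]
        field_simp
      _ ≤ _ := by
        gcongr
        exact le_add_of_nonneg_left (by positivity)
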